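/- Let h ∈ H²₀ be such that a right-continuous version h'' of its partial derivative generates a finite positive measure on [0,1]². Then h̲ = h; that is, h is the unique solution of the minimisation problem min{‖g‖ : g ∈ H²₀, g(s,t) ≥ h(s,t) for all s,t ∈ [0,1]}. -/

import Mathlib

open MeasureTheory Set Filter
open scoped ProbabilityTheory

set_option linter.unusedVariables false

noncomputable section

/-- The closed unit square `[0,1]²` in `ℝ × ℝ`. -/
def unitSq : Set (ℝ × ℝ) := Icc (0:ℝ) 1 ×ˢ Icc (0:ℝ) 1

/-- The inner product of the RKHS `H²₀`, expressed on the (partial) derivatives. -/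
def inner2 (f g : ℝ × ℝ → ℝ) : ℝ := ∫ p in unitSq, f p * g p

/-- The norm of the RKHS `H²₀`, expressed on the (partial) derivatives. -/
def norm2 (f : ℝ × ℝ → ℝ) : ℝ := Real.sqrt (∫ p in unitSq, (f p) ^ 2)

/-- `IsH20 h hd` means `h ∈ H²₀` with (square-integrable) partial derivative `h'' = hd`:
`h(s,t) = ∫_{[0,s]×[0,t]} h''(x,y) λ²(dx,dy)` and `h` vanishes on the boundary of `[0,1]²`. -/
structure IsH20 (h hd : ℝ × ℝ → ℝ) : Prop where
  sq_int : IntegrableOn (fun p => (hd p) ^ 2) unitSq volume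
  repr : ∀ s ∈ Icc (0:ℝ) 1, ∀ t ∈ Icc (0:ℝ) 1,
      h (s, t) = ∫ p in Icc (0:ℝ) s ×ˢ Icc (0:ℝ) t, hd p
  bdry : ∀ s ∈ Icc (0:ℝ) 1, h (0, s) = 0 ∧ h (1, s) = 0 ∧ h (s, 0) = 0 ∧ h (s, 1) = 0

/-- Membership in `V ⊆ H²₀`: nonpositive on the unit square. -/
def InV (h : ℝ × ℝ → ℝ) : Prop := ∀ p ∈ unitSq, h p ≤ 0

/-- Membership in the polar cone `Ṽ := {g ∈ H²₀ : ⟨g, v⟩ ≤ 0 ∀ v ∈ V}` of `V`. -/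
def InPolarV (g gd : ℝ × ℝ → ℝ) : Prop :=
  IsH20 g gd ∧ ∀ v vd, IsH20 v vd → InV v → inner2 gd vd ≤ 0

/-- Membership in the polar cone `W̃ := {g ∈ H²₀ : ⟨g, w⟩ ≥ 0 ∀ w ∈ W}` of
`W = {h ∈ H²₀ : h ≥ 0}`. -/
def InPolarW (g gd : ℝ × ℝ → ℝ) : Prop :=
  IsH20 g gd ∧ ∀ w wd, IsH20 w wd → (∀ p ∈ unitSq, 0 ≤ w p) → 0 ≤ inner2 gd wd

/-- `pr` (with derivative `prd`) is the metric projection onto `Ṽ` of `h ∈ H²₀`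
(with derivative `hd`): `pr ∈ Ṽ` and `pr` minimises the `H²₀`-distance to `h` over `Ṽ`. -/
def IsProjPolarV (h hd pr prd : ℝ × ℝ → ℝ) : Prop :=
  InPolarV pr prd ∧ ∀ g gd, InPolarV g gd →
    norm2 (fun q => hd q - prd q) ≤ norm2 (fun q => hd q - gd q)

/-- `pr` (with derivative `prd`) is the metric projection onto `W̃` of `h ∈ H²₀`
(with derivative `hd`). -/
def IsProjPolarW (h hd pr prd : ℝ × ℝ → ℝ) : Prop :=
  InPolarW pr prd ∧ ∀ g gd, InPolarW g gd →
    norm2 (fun q => hd q - prd q) ≤ norm2 (fun q => hd q - gd q)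

/-- Right-continuity of a function on `ℝ²` (w.r.t. the coordinatewise partial order). -/
def RightCont2 (f : ℝ × ℝ → ℝ) : Prop := ∀ p : ℝ × ℝ, ContinuousWithinAt f (Ici p) p

/-- The right-continuous function `f : [0,1]² → ℝ` generates the finite (positive) measure `μ`
on `[0,1]²`: `μ((s₁,s₂]×(t₁,t₂]) = f(s₂,t₂) − f(s₁,t₂) − f(s₂,t₁) + f(s₁,t₁)` for all
rectangles in the unit square, and `μ` is carried by `[0,1]²`. -/
def GeneratesMeasure (f : ℝ × ℝ → ℝ) (μ : Measure (ℝ × ℝ)) : Prop :=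
  RightCont2 f ∧ IsFiniteMeasure μ ∧ μ unitSqᶜ = 0 ∧
    ∀ s₁ s₂ t₁ t₂ : ℝ, 0 ≤ s₁ → s₁ ≤ s₂ → s₂ ≤ 1 → 0 ≤ t₁ → t₁ ≤ t₂ → t₂ ≤ 1 →
      (μ (Ioc s₁ s₂ ×ˢ Ioc t₁ t₂)).toReal = f (s₂, t₂) - f (s₁, t₂) - f (s₂, t₁) + f (s₁, t₁)

lemma measurableSet_unitSq : MeasurableSet unitSq := measurableSet_Icc.prod measurableSet_Icc

lemma volume_restrict_unitSq : (volume : Measure (ℝ × ℝ)).restrict unitSq =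
    ((volume : Measure ℝ).restrict (Icc 0 1)).prod ((volume : Measure ℝ).restrict (Icc 0 1)) := by
  rw [Measure.prod_restrict]; rfl

instance isFiniteMeasure_restrict_unitSq :
    IsFiniteMeasure ((volume : Measure (ℝ × ℝ)).restrict unitSq) := by
  rw [volume_restrict_unitSq]; infer_instance

lemma Icc_prod_Icc_subset_unitSq {s t : ℝ} (hs : s ≤ 1) (ht : t ≤ 1) :
    Icc (0:ℝ) s ×ˢ Icc (0:ℝ) t ⊆ unitSq :=
  prod_mono (Icc_subset_Icc_right hs) (Icc_subset_Icc_right ht)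

/-- A function on the plane that is right-continuous for the coordinatewise order is Borel. -/
lemma RightCont2.measurable {f : ℝ × ℝ → ℝ} (hf : RightCont2 f) : Measurable f := by
  let u : ℕ → ℝ × ℝ → ℝ × ℝ := fun n p =>
    (((⌊((n:ℝ) + 1) * p.1⌋ + 1 : ℤ) : ℝ) / (n + 1), ((⌊((n:ℝ) + 1) * p.2⌋ + 1 : ℤ) : ℝ) / (n + 1))
  have hlim1 : ∀ x : ℝ, Tendsto (fun n : ℕ => ((⌊((n:ℝ) + 1) * x⌋ + 1 : ℤ) : ℝ) / (n + 1))
      atTop (nhds x) := by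
    intro x
    have h1 : Tendsto (fun n : ℕ => x + 1 / ((n:ℝ) + 1)) atTop (nhds (x + 0)) :=
      tendsto_const_nhds.add tendsto_one_div_add_atTop_nhds_zero_nat
    rw [add_zero] at h1
    refine tendsto_of_tendsto_of_tendsto_of_le_of_le tendsto_const_nhds h1 (fun n => ?_)
      (fun n => ?_)
    · have hn : (0:ℝ) < n + 1 := by positivity
      rw [le_div_iff₀ hn]
      push_cast
      linarith [Int.lt_floor_add_one (((n:ℝ) + 1) * x)]
    · have hn : (0:ℝ) < n + 1 := by positivity
      have h2 : (x + 1 / ((n:ℝ) + 1)) * ((n:ℝ) + 1) = ((n:ℝ) + 1) * x + 1 := by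
        field_simp
      rw [div_le_iff₀ hn, h2]
      push_cast
      linarith [Int.floor_le (((n:ℝ) + 1) * x)]
  have hle : ∀ (n : ℕ) (x : ℝ), x ≤ ((⌊((n:ℝ) + 1) * x⌋ + 1 : ℤ) : ℝ) / (n + 1) := by
    intro n x
    have hn : (0:ℝ) < n + 1 := by positivity
    rw [le_div_iff₀ hn]
    push_cast
    linarith [Int.lt_floor_add_one (((n:ℝ) + 1) * x)]
  refine measurable_of_tendsto_metrizable (f := fun n p => f (u n p)) (fun n => ?_) ?_
  · have h1 : Measurable (fun p : ℝ × ℝ => (⌊((n:ℝ) + 1) * p.1⌋, ⌊((n:ℝ) + 1) * p.2⌋)) := by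
      fun_prop
    exact (measurable_of_countable
      (fun k : ℤ × ℤ => f (((k.1 + 1 : ℤ) : ℝ) / (n + 1), ((k.2 + 1 : ℤ) : ℝ) / (n + 1)))).comp h1
  · rw [tendsto_pi_nhds]
    intro p
    refine (hf p).tendsto.comp (tendsto_nhdsWithin_iff.2 ⟨?_, Eventually.of_forall fun n => ?_⟩)
    · exact (hlim1 p.1).prodMk_nhds (hlim1 p.2)
    · exact ⟨hle n p.1, hle n p.2⟩

/-- If a square-integrable function differs from `a x + b y` by a bounded amount,
then `a` is square-integrable. -/
lemma memLp_two_of_abs_sub_add_le {f : ℝ × ℝ → ℝ} {a b : ℝ → ℝ} {C : ℝ}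
    (hf : Measurable f) (ha : Measurable a) (hsq : IntegrableOn (fun p => (f p) ^ 2) unitSq)
    (hC : ∀ x ∈ Icc (0:ℝ) 1, ∀ y ∈ Icc (0:ℝ) 1, |f (x, y) - a x - b y| ≤ C) :
    MemLp a 2 (volume.restrict (Icc (0:ℝ) 1)) := by
  rw [IntegrableOn, volume_restrict_unitSq] at hsq
  have hne : (volume.restrict (Icc (0:ℝ) 1)) ≠ 0 := by simp
  have : (ae (volume.restrict (Icc (0:ℝ) 1))).NeBot := ae_neBot.2 hne
  obtain ⟨y, hy, hyI⟩ := (hsq.prod_left_ae.and (ae_restrict_mem measurableSet_Icc)).exists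
  have hfy : MemLp (fun x => f (x, y)) 2 (volume.restrict (Icc (0:ℝ) 1)) :=
    (memLp_two_iff_integrable_sq (hf.comp (by fun_prop)).aestronglyMeasurable).2 hy
  refine (hfy.norm.add (memLp_const (C + |b y|))).mono ha.aestronglyMeasurable ?_
  filter_upwards [ae_restrict_mem measurableSet_Icc] with x hx
  have h1 := hC x hx y hyI
  have h2 : |a x| ≤ |f (x, y)| + (C + |b y|) := by
    calc |a x| = |f (x, y) - (f (x, y) - a x - b y) - b y| := by ring_nf
      _ ≤ |f (x, y)| + |f (x, y) - a x - b y| + |b y| :=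
        (abs_sub _ _).trans (add_le_add_left (abs_sub _ _) _)
      _ ≤ _ := by linarith
  simpa using h2.trans (le_abs_self _)

lemma ae_eq_zero_of_forall_setIntegral_Icc_eq_zero {φ : ℝ → ℝ}
    (hφ : IntegrableOn φ (Icc 0 1)) (h0 : ∀ s ∈ Icc (0:ℝ) 1, ∫ x in Icc 0 s, φ x = 0) :
    ∀ᵐ x ∂(volume.restrict (Icc (0:ℝ) 1)), φ x = 0 := by
  have hi : IntervalIntegrable φ volume 0 1 :=
    (intervalIntegrable_iff_integrableOn_Icc_of_le zero_le_one).2 hφ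
  have hne0 : ∀ᵐ x : ℝ, x ≠ 0 := by simp [ae_iff, measure_singleton]
  have hne1 : ∀ᵐ x : ℝ, x ≠ 1 := by simp [ae_iff, measure_singleton]
  rw [ae_restrict_iff' measurableSet_Icc]
  filter_upwards [hi.ae_hasDerivAt_integral, hne0, hne1] with x hx hx0 hx1 hxI
  rw [uIcc_of_le zero_le_one] at hx
  have hd := hx hxI 0 (by simp)
  have hz : HasDerivAt (fun _ : ℝ => (0:ℝ)) 0 x := hasDerivAt_const _ _
  refine hd.unique (hz.congr_of_eventuallyEq ?_)
  have hnhds : Ioo (0:ℝ) 1 ∈ nhds x :=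
    Ioo_mem_nhds (lt_of_le_of_ne hxI.1 (Ne.symm hx0)) (lt_of_le_of_ne hxI.2 hx1)
  filter_upwards [hnhds] with y hy
  rw [intervalIntegral.integral_of_le hy.1.le, ← integral_Icc_eq_integral_Ioc]
  exact h0 y ⟨hy.1.le, hy.2.le⟩

lemma integral_fst_mul_eq_zero {a : ℝ → ℝ} {f : ℝ × ℝ → ℝ} (hf : IntegrableOn f unitSq)
    (h0 : ∀ s ∈ Icc (0:ℝ) 1, ∫ p in Icc (0:ℝ) s ×ˢ Icc (0:ℝ) 1, f p = 0)
    (haf : IntegrableOn (fun p => a p.1 * f p) unitSq) :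
    ∫ p in unitSq, a p.1 * f p = 0 := by
  have hφ : ∀ᵐ x ∂(volume.restrict (Icc (0:ℝ) 1)), ∫ y in Icc (0:ℝ) 1, f (x, y) = 0 := by
    refine ae_eq_zero_of_forall_setIntegral_Icc_eq_zero ?_ (fun s hs => ?_)
    · rw [IntegrableOn, volume_restrict_unitSq] at hf
      exact hf.integral_prod_left
    · exact (setIntegral_prod f (hf.mono_set (Icc_prod_Icc_subset_unitSq hs.2 le_rfl))).symm.trans
        (h0 s hs)
  rw [unitSq, Measure.volume_eq_prod, setIntegral_prod _ haf]
  refine integral_eq_zero_of_ae ?_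
  filter_upwards [hφ] with x hx
  simp [integral_const_mul, hx]

lemma integral_snd_mul_eq_zero {b : ℝ → ℝ} {f : ℝ × ℝ → ℝ} (hf : IntegrableOn f unitSq)
    (h0 : ∀ t ∈ Icc (0:ℝ) 1, ∫ p in Icc (0:ℝ) 1 ×ˢ Icc (0:ℝ) t, f p = 0)
    (hbf : IntegrableOn (fun p => b p.2 * f p) unitSq) :
    ∫ p in unitSq, b p.2 * f p = 0 := by
  have hswap : ∀ {g : ℝ × ℝ → ℝ}, IntegrableOn g unitSq →
      IntegrableOn (fun p => g p.swap) unitSq := by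
    intro g hg
    rw [IntegrableOn, volume_restrict_unitSq] at hg ⊢
    exact hg.swap
  have h := integral_fst_mul_eq_zero (a := b) (hswap hf) (fun s hs => ?_) (hswap hbf)
  · rw [← h, unitSq, Measure.volume_eq_prod]
    exact (setIntegral_prod_swap _ _ (fun p : ℝ × ℝ => b p.2 * f p)).symm
  · exact (setIntegral_prod_swap (μ := volume) (ν := volume) _ _ f).trans (h0 s hs)

lemma IsH20.memLp {v vd : ℝ × ℝ → ℝ} (hv : IsH20 v vd)
    (hm : AEStronglyMeasurable vd (volume.restrict unitSq)) :
    MemLp vd 2 (volume.restrict unitSq) :=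
  (memLp_two_iff_integrable_sq hm).2 hv.sq_int

/-- Fubini for the indicator of `x < a, y < b`: integrating `vd` against the survival function of
`μ` amounts to integrating the primitive of `vd` against `μ`. -/
lemma IsH20.integral_survival_mul {v vd : ℝ × ℝ → ℝ} {μ : Measure (ℝ × ℝ)} [IsFiniteMeasure μ]
    (hμ : μ unitSqᶜ = 0) (hv : IsH20 v vd) (hm : AEStronglyMeasurable vd (volume.restrict unitSq)) :
    Integrable v μ ∧
      ∫ q in unitSq, μ.real (Ioc q.1 1 ×ˢ Ioc q.2 1) * vd q = ∫ p, v p ∂μ := by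
  have hmem : ∀ᵐ p ∂μ, p ∈ unitSq := hμ
  have hint : IntegrableOn vd unitSq := (hv.memLp hm).integrable one_le_two
  let S : Set ((ℝ × ℝ) × (ℝ × ℝ)) := {z | z.1.1 < z.2.1} ∩ {z | z.1.2 < z.2.2}
  have hS : MeasurableSet S :=
    (measurableSet_lt (by fun_prop) (by fun_prop)).inter
      (measurableSet_lt (by fun_prop) (by fun_prop))
  let Φ : ℝ × ℝ → ℝ × ℝ → ℝ := fun q p => S.indicator (fun z => vd z.1) (q, p)
  have hΦ : Integrable (Function.uncurry Φ) ((volume.restrict unitSq).prod μ) :=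
    (hint.comp_fst μ).indicator hS
  have hright : ∀ᵐ p ∂μ, ∫ q in unitSq, Φ q p = v p := by
    filter_upwards [hmem] with p hp
    have h1 : v p = ∫ q in Icc (0:ℝ) p.1 ×ˢ Icc (0:ℝ) p.2, vd q := hv.repr p.1 hp.1 p.2 hp.2
    have hA : MeasurableSet ({q : ℝ × ℝ | q.1 < p.1} ∩ {q : ℝ × ℝ | q.2 < p.2}) :=
      (measurableSet_lt (by fun_prop) (by fun_prop)).inter
        (measurableSet_lt (by fun_prop) (by fun_prop))
    have h2 : ∫ q in unitSq, Φ q p =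
        ∫ q in unitSq ∩ ({q : ℝ × ℝ | q.1 < p.1} ∩ {q : ℝ × ℝ | q.2 < p.2}), vd q :=
      setIntegral_indicator hA
    have h3 : unitSq ∩ ({q : ℝ × ℝ | q.1 < p.1} ∩ {q : ℝ × ℝ | q.2 < p.2}) = Ico (0:ℝ) p.1 ×ˢ Ico (0:ℝ) p.2 := by
      ext q
      have := hp.1.2
      have := hp.2.2
      simp only [unitSq, mem_inter_iff, mem_prod, mem_Icc, mem_ofPred_eq, mem_Ico]
      constructor
      · rintro ⟨⟨⟨_, _⟩, _, _⟩, _, _⟩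
        exact ⟨⟨by linarith, by linarith⟩, by linarith, by linarith⟩
      · rintro ⟨⟨_, _⟩, _, _⟩
        exact ⟨⟨⟨by linarith, by linarith⟩, by linarith, by linarith⟩, by linarith, by linarith⟩
    rw [h1, h2, h3]
    refine setIntegral_congr_set ?_
    rw [Measure.volume_eq_prod]
    exact Measure.set_prod_ae_eq Ico_ae_eq_Icc Ico_ae_eq_Icc
  have hleft : ∀ q ∈ unitSq, ∫ p, Φ q p ∂μ = μ.real (Ioc q.1 1 ×ˢ Ioc q.2 1) * vd q := by
    intro q hq
    have hA : MeasurableSet ({p : ℝ × ℝ | q.1 < p.1} ∩ {p : ℝ × ℝ | q.2 < p.2}) :=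
      (measurableSet_lt (by fun_prop) (by fun_prop)).inter
        (measurableSet_lt (by fun_prop) (by fun_prop))
    have h2 : ∫ p, Φ q p ∂μ = ∫ p in ({p : ℝ × ℝ | q.1 < p.1} ∩ {p : ℝ × ℝ | q.2 < p.2}), vd q ∂μ :=
      integral_indicator hA
    rw [h2, setIntegral_const, smul_eq_mul]
    congr 1
    refine measureReal_congr ?_
    filter_upwards [hmem] with p hp
    refine propext (?_ : (q.1 < p.1 ∧ q.2 < p.2) ↔ p ∈ Ioc q.1 1 ×ˢ Ioc q.2 1)
    have h1 : p.1 ≤ 1 := hp.1.2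
    have h2 : p.2 ≤ 1 := hp.2.2
    simp [mem_prod, h1, h2]
  refine ⟨(hΦ.integral_prod_right).congr hright, ?_⟩
  calc ∫ q in unitSq, μ.real (Ioc q.1 1 ×ˢ Ioc q.2 1) * vd q
      = ∫ q in unitSq, ∫ p, Φ q p ∂μ :=
        (setIntegral_congr_fun measurableSet_unitSq hleft).symm
    _ = ∫ p, (∫ q in unitSq, Φ q p) ∂μ := integral_integral_swap hΦ
    _ = ∫ p, v p ∂μ := integral_congr_ae hright

/-- Integration by parts: if `f` generates `μ`, then `⟨f, v''⟩ = ∫ v dμ` for `v ∈ H²₀`. -/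
lemma GeneratesMeasure.inner2_eq {f v vd : ℝ × ℝ → ℝ} {μ : Measure (ℝ × ℝ)}
    (hf : GeneratesMeasure f μ) (hsq : IntegrableOn (fun p => (f p) ^ 2) unitSq)
    (hv : IsH20 v vd) (hm : AEStronglyMeasurable vd (volume.restrict unitSq)) :
    Integrable v μ ∧ inner2 f vd = ∫ p, v p ∂μ := by
  obtain ⟨hrc, hfin, hsupp, hgen⟩ := hf
  obtain ⟨hvi, hsurv⟩ := hv.integral_survival_mul hsupp hm
  refine ⟨hvi, ?_⟩
  have hfm := hrc.measurable
  let a : ℝ → ℝ := fun x => f (x, 1)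
  let b : ℝ → ℝ := fun y => f (1, y) - f (1, 1)
  have ha : Measurable a := hfm.comp (by fun_prop)
  have hb : Measurable b := (hfm.comp (by fun_prop)).sub_const _
  have hdecomp : ∀ x ∈ Icc (0:ℝ) 1, ∀ y ∈ Icc (0:ℝ) 1,
      f (x, y) - a x - b y = μ.real (Ioc x 1 ×ˢ Ioc y 1) := by
    intro x hx y hy
    have := hgen x 1 y 1 hx.1 hx.2 le_rfl hy.1 hy.2 le_rfl
    simp only [a, b, Measure.real, this]
    ring
  have hbound : ∀ x ∈ Icc (0:ℝ) 1, ∀ y ∈ Icc (0:ℝ) 1, |f (x, y) - a x - b y| ≤ μ.real univ := by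
    intro x hx y hy
    rw [hdecomp x hx y hy, abs_of_nonneg measureReal_nonneg]
    exact measureReal_mono (subset_univ _)
  have haL : MemLp a 2 (volume.restrict (Icc (0:ℝ) 1)) :=
    memLp_two_of_abs_sub_add_le hfm ha hsq hbound
  have hsq' : IntegrableOn (fun p : ℝ × ℝ => (f p.swap) ^ 2) unitSq := by
    rw [IntegrableOn, volume_restrict_unitSq] at hsq ⊢
    exact hsq.swap
  have hbL : MemLp b 2 (volume.restrict (Icc (0:ℝ) 1)) := by
    refine memLp_two_of_abs_sub_add_le (f := fun p => f p.swap) (b := a)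
      (hfm.comp measurable_swap) hb hsq' (fun x hx y hy => ?_) (C := μ.real univ)
    have := hbound y hy x hx
    rwa [sub_right_comm] at this
  have hvL := hv.memLp hm
  have hvint : IntegrableOn vd unitSq := hvL.integrable one_le_two
  have haL2 : MemLp (fun p : ℝ × ℝ => a p.1) 2 (volume.restrict unitSq) := by
    rw [volume_restrict_unitSq]
    exact haL.comp_fst _
  have hbL2 : MemLp (fun p : ℝ × ℝ => b p.2) 2 (volume.restrict unitSq) := by
    rw [volume_restrict_unitSq]
    exact hbL.comp_snd _
  have hfL2 : MemLp f 2 (volume.restrict unitSq) :=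
    (memLp_two_iff_integrable_sq hfm.aestronglyMeasurable).2 hsq
  have hai : IntegrableOn (fun p : ℝ × ℝ => a p.1 * vd p) unitSq := haL2.integrable_mul hvL
  have hbi : IntegrableOn (fun p : ℝ × ℝ => b p.2 * vd p) unitSq := hbL2.integrable_mul hvL
  have hfi : IntegrableOn (fun p : ℝ × ℝ => f p * vd p) unitSq := hfL2.integrable_mul hvL
  have ha0 := integral_fst_mul_eq_zero hvint
    (fun s hs => (hv.repr s hs 1 (by simp)).symm.trans (hv.bdry s hs).2.2.2) hai
  have hb0 := integral_snd_mul_eq_zero hvint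
    (fun t ht => (hv.repr 1 (by simp) t ht).symm.trans (hv.bdry t ht).2.1) hbi
  rw [← hsurv]
  have hcongr : ∫ q in unitSq, μ.real (Ioc q.1 1 ×ˢ Ioc q.2 1) * vd q =
      ∫ q in unitSq, (f q * vd q - a q.1 * vd q - b q.2 * vd q) := by
    refine setIntegral_congr_fun measurableSet_unitSq (fun q hq => ?_)
    have := hdecomp q.1 hq.1 q.2 hq.2
    simp only [← this]
    ring
  rw [hcongr, integral_sub, integral_sub hfi hai, ha0, hb0, inner2]
  · ring
  · exact hfi.sub hai
  · exact hbi

lemma aestronglyMeasurable_unitSq_of_forall_lt {f : ℝ × ℝ → ℝ}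
    (hf : ∀ s ∈ Ioo (0:ℝ) 1, AEStronglyMeasurable f
      (volume.restrict (Icc (0:ℝ) s ×ˢ Icc (0:ℝ) s))) :
    AEStronglyMeasurable f (volume.restrict unitSq) := by
  have hae : unitSq =ᵐ[volume] Ico (0:ℝ) 1 ×ˢ Ico (0:ℝ) 1 := by
    rw [Measure.volume_eq_prod]
    exact (Measure.set_prod_ae_eq Ico_ae_eq_Icc Ico_ae_eq_Icc).symm
  rw [Measure.restrict_congr_set hae]
  have hsub : Ico (0:ℝ) 1 ×ˢ Ico (0:ℝ) 1 ⊆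
      ⋃ n : ℕ, Icc (0:ℝ) (1 - 1 / ((n:ℝ) + 2)) ×ˢ Icc (0:ℝ) (1 - 1 / ((n:ℝ) + 2)) := by
    rintro ⟨x, y⟩ ⟨⟨hx0, hx1⟩, hy0, hy1⟩
    obtain ⟨n, hn⟩ := exists_nat_one_div_lt (lt_min (sub_pos.2 hx1) (sub_pos.2 hy1))
    have h2 : 1 / ((n:ℝ) + 2) ≤ 1 / ((n:ℝ) + 1) := by gcongr; norm_num
    have h3 := hn.trans_le (min_le_left _ _)
    have h4 := hn.trans_le (min_le_right _ _)
    simp only at h3 h4 hx0 hy0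
    exact mem_iUnion.2 ⟨n, ⟨hx0, by dsimp only; linarith⟩, ⟨hy0, by dsimp only; linarith⟩⟩
  refine AEStronglyMeasurable.mono_measure (AEStronglyMeasurable.iUnion fun n => hf _ ?_)
    (Measure.restrict_mono_set _ hsub)
  have h1 : (0:ℝ) < (n:ℝ) + 2 := by positivity
  have h2 : 1 / ((n:ℝ) + 2) < 1 := by
    rw [div_lt_one h1]
    linarith [(Nat.cast_nonneg n : (0:ℝ) ≤ n)]
  exact ⟨by linarith, by linarith [one_div_pos.2 h1]⟩

lemma IsH20.eq_zero_of_not_aestronglyMeasurable {v vd : ℝ × ℝ → ℝ} (hv : IsH20 v vd) {s t : ℝ}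
    (hs : s ∈ Icc (0:ℝ) 1) (ht : t ∈ Icc (0:ℝ) 1)
    (hn : ¬ AEStronglyMeasurable vd (volume.restrict (Icc (0:ℝ) s ×ˢ Icc (0:ℝ) t))) :
    v (s, t) = 0 := by
  rw [hv.repr s hs t ht]
  exact integral_undef fun h => hn h.1

lemma IsH20.eq_of_ae_eq {f fd g gd : ℝ × ℝ → ℝ} (hf : IsH20 f fd) (hg : IsH20 g gd)
    (h : fd =ᵐ[volume.restrict unitSq] gd) : ∀ p ∈ unitSq, f p = g p := by
  rintro ⟨s, t⟩ ⟨hs, ht⟩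
  rw [hf.repr s hs t ht, hg.repr s hs t ht]
  exact integral_congr_ae
    (ae_restrict_of_ae_restrict_of_subset (Icc_prod_Icc_subset_unitSq hs.2 ht.2) h)

lemma ae_eq_zero_of_integral_sq_nonpos {f : ℝ × ℝ → ℝ}
    (hf : IntegrableOn (fun p => (f p) ^ 2) unitSq) (h : ∫ p in unitSq, (f p) ^ 2 ≤ 0) :
    f =ᵐ[volume.restrict unitSq] 0 := by
  have h0 : ∫ p in unitSq, (f p) ^ 2 = 0 :=
    le_antisymm h (integral_nonneg fun _ => sq_nonneg _)
  filter_upwards [(integral_eq_zero_iff_of_nonneg (fun p => sq_nonneg (f p)) hf).1 h0] with p hp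
  simpa using hp

/-- The derivative of an element of the polar cone is a.e. measurable: otherwise its
restriction to the non-measurable region would be the derivative of `0 ∈ V`. -/
lemma InPolarV.aestronglyMeasurable {g gd : ℝ × ℝ → ℝ} (hg : InPolarV g gd) :
    AEStronglyMeasurable gd (volume.restrict unitSq) := by
  let T := {q : ℚ × ℚ // AEStronglyMeasurable gd
    (volume.restrict (Icc (0:ℝ) q.1 ×ˢ Icc (0:ℝ) q.2))}
  let C : Set (ℝ × ℝ) := ⋃ q : T, Icc (0:ℝ) (q.1.1 : ℝ) ×ˢ Icc (0:ℝ) (q.1.2 : ℝ)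
  have hC : MeasurableSet C := MeasurableSet.iUnion fun q => measurableSet_Icc.prod measurableSet_Icc
  have hgC : AEStronglyMeasurable gd (volume.restrict C) := AEStronglyMeasurable.iUnion fun q => q.2
  have hgC' : AEStronglyMeasurable (C.indicator gd) volume :=
    (aestronglyMeasurable_indicator_iff hC).2 hgC
  let vd : ℝ × ℝ → ℝ := Cᶜ.indicator gd
  have hsum : ∀ p, gd p = C.indicator gd p + vd p := fun p =>
    (congrFun (indicator_self_add_compl C gd) p).symm
  have hsq : IntegrableOn (fun p => (vd p) ^ 2) unitSq := by
    have : (fun p => (vd p) ^ 2) = Cᶜ.indicator (fun p => (gd p) ^ 2) := by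
      ext p
      by_cases hp : p ∈ Cᶜ <;> simp [vd, hp]
    rw [this]
    exact hg.1.sq_int.indicator hC.compl
  have hv : IsH20 (fun _ => 0) vd := by
    refine ⟨hsq, fun s hs t ht => ?_, fun s _ => ⟨rfl, rfl, rfl, rfl⟩⟩
    by_cases hm : AEStronglyMeasurable vd (volume.restrict (Icc (0:ℝ) s ×ˢ Icc (0:ℝ) t))
    · have hgm : AEStronglyMeasurable gd (volume.restrict (Icc (0:ℝ) s ×ˢ Icc (0:ℝ) t)) := by
        rw [show gd = fun p => C.indicator gd p + vd p from funext hsum]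
        exact hgC'.restrict.add hm
      have hsub : Ico (0:ℝ) s ×ˢ Ico (0:ℝ) t ⊆ C := by
        rintro ⟨x, y⟩ ⟨⟨hx0, hx1⟩, hy0, hy1⟩
        obtain ⟨q, hxq, hqs⟩ := exists_rat_btwn hx1
        obtain ⟨r, hyr, hrt⟩ := exists_rat_btwn hy1
        refine mem_iUnion.2 ⟨⟨(q, r), ?_⟩, ⟨hx0, hxq.le⟩, ⟨hy0, hyr.le⟩⟩
        exact hgm.mono_measure (Measure.restrict_mono_set _
          (prod_mono (Icc_subset_Icc_right hqs.le) (Icc_subset_Icc_right hrt.le)))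
      have hae : (Icc (0:ℝ) s ×ˢ Icc (0:ℝ) t : Set (ℝ × ℝ)) =ᵐ[volume]
          Ico (0:ℝ) s ×ˢ Ico (0:ℝ) t := by
        rw [Measure.volume_eq_prod]
        exact (Measure.set_prod_ae_eq Ico_ae_eq_Icc Ico_ae_eq_Icc).symm
      rw [setIntegral_congr_set hae]
      refine (setIntegral_eq_zero_of_forall_eq_zero fun p hp => ?_).symm
      exact indicator_of_notMem (notMem_compl_iff.2 (hsub hp)) _
    · exact (integral_undef fun h => hm h.1).symm
  have hle := hg.2 _ vd hv (fun _ _ => le_rfl)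
  have hin : inner2 gd vd = ∫ p in unitSq, (vd p) ^ 2 := by
    refine integral_congr_ae (Eventually.of_forall fun p => ?_)
    by_cases hp : p ∈ Cᶜ <;> simp [vd, hp, sq]
  rw [hin] at hle
  have hzero := ae_eq_zero_of_integral_sq_nonpos hsq hle
  rw [show gd = fun p => C.indicator gd p + vd p from funext hsum]
  exact hgC'.restrict.add (aestronglyMeasurable_const.congr hzero.symm)

lemma GeneratesMeasure.inner2_nonpos {f v vd : ℝ × ℝ → ℝ} {μ : Measure (ℝ × ℝ)}
    (hf : GeneratesMeasure f μ) (hsq : IntegrableOn (fun p => (f p) ^ 2) unitSq)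
    (hv : IsH20 v vd) (hm : AEStronglyMeasurable vd (volume.restrict unitSq)) (hV : InV v) :
    inner2 f vd ≤ 0 := by
  rw [(hf.inner2_eq hsq hv hm).2]
  have hmem : ∀ᵐ p ∂μ, p ∈ unitSq := hf.2.2.1
  exact integral_nonpos_of_ae (hmem.mono hV)

lemma IsH20.inPolarV_of_ae_ne_zero {f fd : ℝ × ℝ → ℝ} (hf : IsH20 f fd) (hfm : Measurable fd)
    (hne : ∀ᵐ p ∂(volume.restrict unitSq), fd p ≠ 0)
    (h : ∀ v vd, IsH20 v vd → AEStronglyMeasurable vd (volume.restrict unitSq) → InV v →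
      inner2 fd vd ≤ 0) : InPolarV f fd := by
  refine ⟨hf, fun v vd hv hV => ?_⟩
  by_cases hi : IntegrableOn (fun p => fd p * vd p) unitSq
  · refine h v vd hv ?_ hV
    have h1 : AEStronglyMeasurable (fun p => (fd p)⁻¹ * (fd p * vd p)) (volume.restrict unitSq) :=
      hfm.inv.aestronglyMeasurable.mul hi.1
    refine h1.congr ?_
    filter_upwards [hne] with p hp
    exact inv_mul_cancel_left₀ hp _
  · exact (integral_undef hi).le

lemma isH20_prod_mul {φ φd ψ ψd : ℝ → ℝ} (hφm : MemLp φd 2 (volume.restrict (Icc (0:ℝ) 1)))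
    (hψm : MemLp ψd 2 (volume.restrict (Icc (0:ℝ) 1)))
    (hφ : ∀ s ∈ Icc (0:ℝ) 1, ∫ x in Icc (0:ℝ) s, φd x = φ s)
    (hψ : ∀ s ∈ Icc (0:ℝ) 1, ∫ x in Icc (0:ℝ) s, ψd x = ψ s)
    (hφ0 : φ 0 = 0) (hφ1 : φ 1 = 0) (hψ0 : ψ 0 = 0) (hψ1 : ψ 1 = 0) :
    IsH20 (fun p => φ p.1 * ψ p.2) (fun p => φd p.1 * ψd p.2) := by
  refine ⟨?_, fun s hs t ht => ?_, fun s _ => by simp [hφ0, hφ1, hψ0, hψ1]⟩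
  · rw [IntegrableOn, volume_restrict_unitSq]
    simp_rw [mul_pow]
    exact hφm.integrable_sq.mul_prod hψm.integrable_sq
  · rw [Measure.volume_eq_prod, setIntegral_prod_mul, hφ s hs, hψ t ht]

lemma isH20_sub_half_mul_sub_half :
    IsH20 (fun p => ((p.1 ^ 2 - p.1) / 2) * ((p.2 ^ 2 - p.2) / 2))
      (fun p => (p.1 - 1 / 2) * (p.2 - 1 / 2)) := by
  have hm : MemLp (fun x : ℝ => x - 1 / 2) 2 (volume.restrict (Icc (0:ℝ) 1)) := by
    have hc : Continuous (fun x : ℝ => x - 1 / 2) := by fun_prop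
    refine (memLp_two_iff_integrable_sq hc.aestronglyMeasurable).2 ?_
    exact (hc.pow 2).continuousOn.integrableOn_compact isCompact_Icc
  have hi : ∀ s ∈ Icc (0:ℝ) 1, ∫ x in Icc (0:ℝ) s, (x - 1 / 2) = (s ^ 2 - s) / 2 := by
    intro s hs
    rw [integral_Icc_eq_integral_Ioc, ← intervalIntegral.integral_of_le hs.1,
      intervalIntegral.integral_sub (by simp) (by simp)]
    simp
    ring
  exact isH20_prod_mul hm hm hi hi (by norm_num) (by norm_num) (by norm_num) (by norm_num)

lemma generatesMeasure_sub_half_mul_sub_half :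
    GeneratesMeasure (fun p => (p.1 - 1 / 2) * (p.2 - 1 / 2)) (volume.restrict unitSq) := by
  refine ⟨fun p => Continuous.continuousWithinAt (by fun_prop), inferInstance, ?_, ?_⟩
  · rw [Measure.restrict_apply measurableSet_unitSq.compl]
    simp
  · intro s₁ s₂ t₁ t₂ h1 h2 h3 h4 h5 h6
    have hsub : Ioc s₁ s₂ ×ˢ Ioc t₁ t₂ ⊆ unitSq := by
      rintro ⟨x, y⟩ ⟨⟨a, b⟩, c, d⟩
      dsimp only at a b c d
      exact ⟨⟨by dsimp only; linarith, by dsimp only; linarith⟩,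
        ⟨by dsimp only; linarith, by dsimp only; linarith⟩⟩
    rw [Measure.restrict_apply (measurableSet_Ioc.prod measurableSet_Ioc),
      inter_eq_self_of_subset_left hsub, Measure.volume_eq_prod, Measure.prod_prod,
      Real.volume_Ioc, Real.volume_Ioc, ENNReal.toReal_mul, ENNReal.toReal_ofReal (by linarith),
      ENNReal.toReal_ofReal (by linarith)]
    ring

lemma ae_sub_half_mul_sub_half_ne_zero :
    ∀ᵐ p : ℝ × ℝ, (p.1 - 1 / 2) * (p.2 - 1 / 2) ≠ 0 := by
  have h : ∀ᵐ x : ℝ, x ≠ 1 / 2 := by simp [ae_iff, measure_singleton]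
  have h1 : ∀ᵐ p : ℝ × ℝ, p.1 ≠ 1 / 2 := Measure.quasiMeasurePreserving_fst.ae h
  have h2 : ∀ᵐ p : ℝ × ℝ, p.2 ≠ 1 / 2 := Measure.quasiMeasurePreserving_snd.ae h
  filter_upwards [h1, h2] with p hp1 hp2
  exact mul_ne_zero (sub_ne_zero.2 hp1) (sub_ne_zero.2 hp2)

lemma IsH20.add_const_mul {f fd g gd : ℝ × ℝ → ℝ} (hf : IsH20 f fd) (hg : IsH20 g gd)
    (hfm : AEStronglyMeasurable fd (volume.restrict unitSq))
    (hgm : AEStronglyMeasurable gd (volume.restrict unitSq)) (c : ℝ) :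
    IsH20 (fun p => f p + c * g p) (fun p => fd p + c * gd p) := by
  have hfL := hf.memLp hfm
  have hgL := (hg.memLp hgm).const_mul c
  refine ⟨(hfL.add hgL).integrable_sq, fun s hs t ht => ?_, fun s hs => ?_⟩
  · have hsub := Icc_prod_Icc_subset_unitSq hs.2 ht.2
    have hfi : IntegrableOn fd unitSq := hfL.integrable one_le_two
    have hgi : IntegrableOn (fun p => c * gd p) unitSq := hgL.integrable one_le_two
    rw [integral_add (hfi.mono_set hsub) (hgi.mono_set hsub), integral_const_mul,
      ← hf.repr s hs t ht, ← hg.repr s hs t ht]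
  · obtain ⟨h1, h2, h3, h4⟩ := hf.bdry s hs
    obtain ⟨k1, k2, k3, k4⟩ := hg.bdry s hs
    simp [h1, h2, h3, h4, k1, k2, k3, k4]

/-- Elements of the polar cone with derivative arbitrarily close to `hd`. -/
lemma GeneratesMeasure.exists_inPolarV_norm2_sub_lt {h hd : ℝ × ℝ → ℝ} {μ : Measure (ℝ × ℝ)}
    (hμ : GeneratesMeasure hd μ) (hh : IsH20 h hd) {δ : ℝ} (hδ : 0 < δ) :
    ∃ g gd, InPolarV g gd ∧ norm2 (fun q => hd q - gd q) < δ := by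
  set k : ℝ × ℝ → ℝ := fun p => (p.1 - 1 / 2) * (p.2 - 1 / 2) with hk
  have hkH := isH20_sub_half_mul_sub_half
  have hkG := generatesMeasure_sub_half_mul_sub_half
  have hkm : Measurable k := by fun_prop
  have hdm : Measurable hd := hμ.1.measurable
  have hcount := Measure.countable_meas_level_set_pos (μ := volume.restrict unitSq)
    (g := fun p => -(hd p / k p)) (by fun_prop)
  have hK : 0 ≤ norm2 k := Real.sqrt_nonneg _
  have hpos : 0 < δ / (norm2 k + 1) := by positivity
  obtain ⟨ε, hεI, hε⟩ : ∃ ε ∈ Ioo 0 (δ / (norm2 k + 1)),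
      ε ∉ {t : ℝ | 0 < (volume.restrict unitSq) {p | -(hd p / k p) = t}} := by
    by_contra! hcon
    exact (Cardinal.Real.Ioo_countable_iff.not.2 (not_le.2 hpos)) (hcount.mono hcon)
  have hε0 : (volume.restrict unitSq) {p | -(hd p / k p) = ε} = 0 := by
    simpa using hε
  have hne : ∀ᵐ p ∂(volume.restrict unitSq), hd p + ε * k p ≠ 0 := by
    have h1 : ∀ᵐ p ∂(volume.restrict unitSq), -(hd p / k p) ≠ ε := by
      rw [ae_iff]
      simpa using hε0
    filter_upwards [h1, ae_restrict_of_ae ae_sub_half_mul_sub_half_ne_zero] with p hp hkp h0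
    apply hp
    have hkp' : k p ≠ 0 := hkp
    field_simp
    linarith
  refine ⟨_, _, (hh.add_const_mul hkH hdm.aestronglyMeasurable hkm.aestronglyMeasurable
    ε).inPolarV_of_ae_ne_zero (by fun_prop) hne (fun v vd hv hm hV => ?_), ?_⟩
  · have h1 := hμ.inner2_nonpos hh.sq_int hv hm hV
    have h2 := hkG.inner2_nonpos hkH.sq_int hv hm hV
    have hvL := hv.memLp hm
    have i1 : IntegrableOn (fun p => hd p * vd p) unitSq :=
      (hh.memLp hdm.aestronglyMeasurable).integrable_mul hvL
    have i2 : IntegrableOn (fun p => k p * vd p) unitSq :=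
      (hkH.memLp hkm.aestronglyMeasurable).integrable_mul hvL
    have h3 : inner2 (fun p => hd p + ε * k p) vd = inner2 hd vd + ε * inner2 k vd := by
      simp only [inner2, add_mul, mul_assoc]
      rw [integral_add i1 (i2.const_mul ε), integral_const_mul]
    rw [h3]
    nlinarith [hεI.1]
  · have h1 : norm2 (fun q => hd q - (hd q + ε * k q)) = ε * norm2 k := by
      have : ∀ q, (hd q - (hd q + ε * k q)) ^ 2 = ε ^ 2 * (k q) ^ 2 := fun q => by ring
      simp only [norm2, this]
      rw [integral_const_mul, Real.sqrt_mul (sq_nonneg _), Real.sqrt_sq hεI.1.le]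
    have h2 : ε * (norm2 k + 1) < δ := (lt_div_iff₀ (by positivity)).1 hεI.2
    calc norm2 (fun q => hd q - (hd q + ε * k q)) = ε * norm2 k := h1
      _ < δ := by nlinarith [hεI.1]

lemma Icc_inter_Iic_eq {a b c : ℝ} : Icc a b ∩ Iic c = Icc a (min b c) := by
  ext x
  simp [and_assoc]

/-- The Green function of `H²₀` at `(s, t)`, with its mixed derivative. -/
lemma isH20_green {s t : ℝ} (hs : s ∈ Icc (0:ℝ) 1) (ht : t ∈ Icc (0:ℝ) 1) :
    IsH20 (fun p => (min p.1 s - s * p.1) * (min p.2 t - t * p.2))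
      (fun p => ((Iic s).indicator 1 p.1 - s) * ((Iic t).indicator 1 p.2 - t)) := by
  have hm : ∀ r : ℝ, MemLp (fun x : ℝ => (Iic r).indicator (1 : ℝ → ℝ) x - r) 2
      (volume.restrict (Icc (0:ℝ) 1)) := fun r =>
    (memLp_indicator_const 2 measurableSet_Iic (1:ℝ) (Or.inr (measure_ne_top _ _))).sub
      (memLp_const r)
  have hi : ∀ r ∈ Icc (0:ℝ) 1, ∀ x ∈ Icc (0:ℝ) 1,
      ∫ y in Icc (0:ℝ) x, ((Iic r).indicator (1 : ℝ → ℝ) y - r) = min x r - r * x := by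
    intro r hr x hx
    have h1 : IntegrableOn ((Iic r).indicator (1 : ℝ → ℝ)) (Icc 0 x) :=
      (integrable_const (1:ℝ)).indicator measurableSet_Iic
    rw [integral_sub h1 (integrable_const r), setIntegral_indicator measurableSet_Iic]
    have h2 : Icc 0 x ∩ Iic r = Icc 0 (min x r) := Icc_inter_Iic_eq
    have h3 : 0 ≤ min x r := le_min hx.1 hr.1
    simp [h2, h3, hx.1, mul_comm]
  have h0 : ∀ r ∈ Icc (0:ℝ) 1, min 0 r - r * 0 = 0 := fun r hr => by simp [hr.1]
  have h1 : ∀ r ∈ Icc (0:ℝ) 1, min 1 r - r * 1 = 0 := fun r hr => by simp [hr.2]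
  exact isH20_prod_mul (hm s) (hm t) (hi s hs) (hi t ht) (h0 s hs) (h1 s hs) (h0 t ht) (h1 t ht)

/-- The reproducing property of the Green function. -/
lemma IsH20.inner2_green {h hd : ℝ × ℝ → ℝ} (hh : IsH20 h hd)
    (hm : AEStronglyMeasurable hd (volume.restrict unitSq)) {s t : ℝ}
    (hs : s ∈ Icc (0:ℝ) 1) (ht : t ∈ Icc (0:ℝ) 1) :
    inner2 hd (fun p => ((Iic s).indicator 1 p.1 - s) * ((Iic t).indicator 1 p.2 - t)) =
      h (s, t) := by
  have hi : IntegrableOn hd unitSq := (hh.memLp hm).integrable one_le_two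
  have hone : (1:ℝ) ∈ Icc (0:ℝ) 1 := by simp
  have key : ∀ x ∈ Icc (0:ℝ) 1, ∀ y ∈ Icc (0:ℝ) 1,
      IntegrableOn ((Iic x ×ˢ Iic y).indicator hd) unitSq ∧
      ∫ p in unitSq, (Iic x ×ˢ Iic y).indicator hd p = h (x, y) := by
    intro x hx y hy
    have hS : MeasurableSet (Iic x ×ˢ Iic y) := measurableSet_Iic.prod measurableSet_Iic
    refine ⟨hi.indicator hS, ?_⟩
    rw [setIntegral_indicator hS, hh.repr x hx y hy, unitSq, prod_inter_prod, Icc_inter_Iic_eq,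
      Icc_inter_Iic_eq, min_eq_right hx.2, min_eq_right hy.2]
  obtain ⟨i1, e1⟩ := key s hs t ht
  obtain ⟨i2, e2⟩ := key s hs 1 hone
  obtain ⟨i3, e3⟩ := key 1 hone t ht
  obtain ⟨i4, e4⟩ := key 1 hone 1 hone
  have hcongr : inner2 hd (fun p => ((Iic s).indicator 1 p.1 - s) * ((Iic t).indicator 1 p.2 - t)) =
      ∫ p in unitSq, ((Iic s ×ˢ Iic t).indicator hd p - t * (Iic s ×ˢ Iic 1).indicator hd p -
        s * (Iic 1 ×ˢ Iic t).indicator hd p + s * t * (Iic 1 ×ˢ Iic 1).indicator hd p) := by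
    refine setIntegral_congr_fun measurableSet_unitSq fun p hp => ?_
    have hp1 : p.1 ≤ 1 := hp.1.2
    have hp2 : p.2 ≤ 1 := hp.2.2
    by_cases h1 : p.1 ≤ s <;> by_cases h2 : p.2 ≤ t <;>
      simp [indicator, Prod.le_def, h1, h2, hp1, hp2] <;> ring
  have j2 := i2.const_mul t
  have j3 := i3.const_mul s
  have j4 := i4.const_mul (s * t)
  have j12 : IntegrableOn (fun p => (Iic s ×ˢ Iic t).indicator hd p -
      t * (Iic s ×ˢ Iic 1).indicator hd p) unitSq := i1.sub j2
  have j123 : IntegrableOn (fun p => (Iic s ×ˢ Iic t).indicator hd p -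
      t * (Iic s ×ˢ Iic 1).indicator hd p - s * (Iic 1 ×ˢ Iic t).indicator hd p) unitSq :=
    j12.sub j3
  rw [hcongr, integral_add j123 j4, integral_sub j12 j3, integral_sub i1 j2, integral_const_mul, integral_const_mul, integral_const_mul, e1, e2, e3, e4,
    (hh.bdry s hs).2.2.2, (hh.bdry t ht).2.1, (hh.bdry 1 hone).2.1]
  ring

lemma min_sub_mul_pos {x r : ℝ} (hx : x ∈ Ioo (0:ℝ) 1) (hr : r ∈ Ioo (0:ℝ) 1) :
    0 < min x r - r * x := by
  obtain ⟨hx0, hx1⟩ := hx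
  obtain ⟨hr0, hr1⟩ := hr
  rcases min_cases x r with ⟨h, _⟩ | ⟨h, _⟩ <;> rw [h] <;> nlinarith

lemma min_sub_mul_nonneg {x r : ℝ} (hx : x ∈ Icc (0:ℝ) 1) (hr : r ∈ Icc (0:ℝ) 1) :
    0 ≤ min x r - r * x := by
  obtain ⟨hx0, hx1⟩ := hx
  obtain ⟨hr0, hr1⟩ := hr
  rcases min_cases x r with ⟨h, _⟩ | ⟨h, _⟩ <;> rw [h] <;> nlinarith

/-- Strong minimum principle: if `h` generates a positive measure and is nonpositive at some
interior point, then it is trivial. -/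
lemma GeneratesMeasure.integral_sq_eq_zero {h hd : ℝ × ℝ → ℝ} {μ : Measure (ℝ × ℝ)}
    (hμ : GeneratesMeasure hd μ) (hh : IsH20 h hd) {s t : ℝ} (hs : s ∈ Ioo (0:ℝ) 1)
    (ht : t ∈ Ioo (0:ℝ) 1) (hle : h (s, t) ≤ 0) : ∫ p in unitSq, (hd p) ^ 2 = 0 := by
  have hdm : AEStronglyMeasurable hd (volume.restrict unitSq) :=
    hμ.1.measurable.aestronglyMeasurable
  have hmem : ∀ᵐ p ∂μ, p ∈ unitSq := hμ.2.2.1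
  have hs' := Ioo_subset_Icc_self hs
  have ht' := Ioo_subset_Icc_self ht
  have hG := isH20_green hs' ht'
  have hGm : Measurable (fun p : ℝ × ℝ => ((Iic s).indicator (1 : ℝ → ℝ) p.1 - s) *
      ((Iic t).indicator (1 : ℝ → ℝ) p.2 - t)) :=
    (((measurable_one.indicator measurableSet_Iic).comp measurable_fst).sub_const s).mul
      (((measurable_one.indicator measurableSet_Iic).comp measurable_snd).sub_const t)
  obtain ⟨hGi, hGe⟩ := hμ.inner2_eq hh.sq_int hG hGm.aestronglyMeasurable
  rw [hh.inner2_green hdm hs' ht'] at hGe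
  have hnn : 0 ≤ᵐ[μ] fun p => (min p.1 s - s * p.1) * (min p.2 t - t * p.2) :=
    hmem.mono fun p hp => mul_nonneg (min_sub_mul_nonneg hp.1 hs') (min_sub_mul_nonneg hp.2 ht')
  have hzero := (integral_eq_zero_iff_of_nonneg_ae hnn hGi).1
    (le_antisymm (hGe ▸ hle) (integral_nonneg_of_ae hnn))
  have hvan : h =ᵐ[μ] 0 := by
    filter_upwards [hmem, hzero] with p hp hp0
    obtain ⟨x, y⟩ := p
    obtain ⟨hx, hy⟩ := hp
    obtain ⟨b1, b2, -, -⟩ := hh.bdry y hy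
    obtain ⟨-, -, b3, b4⟩ := hh.bdry x hx
    by_cases hxI : x ∈ Ioo (0:ℝ) 1
    · by_cases hyI : y ∈ Ioo (0:ℝ) 1
      · exact absurd hp0 (mul_pos (min_sub_mul_pos hxI hs) (min_sub_mul_pos hyI ht)).ne'
      · rcases eq_endpoints_or_mem_Ioo_of_mem_Icc hy with rfl | rfl | h
        exacts [b3, b4, absurd h hyI]
    · rcases eq_endpoints_or_mem_Ioo_of_mem_Icc hx with rfl | rfl | h
      exacts [b1, b2, absurd h hxI]
  have hself := (hμ.inner2_eq hh.sq_int hh hdm).2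
  rw [integral_eq_zero_of_ae hvan] at hself
  simpa only [inner2, sq] using hself

/-- Pythagorean inequality for majorants of `h`. -/
lemma GeneratesMeasure.integral_sub_sq_le {h hd g gd : ℝ × ℝ → ℝ}
    {μ : Measure (ℝ × ℝ)} (hμ : GeneratesMeasure hd μ) (hh : IsH20 h hd) (hg : IsH20 g gd)
    (hgm : AEStronglyMeasurable gd (volume.restrict unitSq)) (hle : ∀ p ∈ unitSq, h p ≤ g p) :
    IntegrableOn (fun p => (hd p - gd p) ^ 2) unitSq ∧
      ∫ p in unitSq, (hd p - gd p) ^ 2 ≤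
        (∫ p in unitSq, (gd p) ^ 2) - ∫ p in unitSq, (hd p) ^ 2 := by
  have hdm : AEStronglyMeasurable hd (volume.restrict unitSq) :=
    hμ.1.measurable.aestronglyMeasurable
  have hdL := hh.memLp hdm
  have hgL := hg.memLp hgm
  have hsub : IntegrableOn (fun p => (hd p - gd p) ^ 2) unitSq := (hdL.sub hgL).integrable_sq
  have hcross : IntegrableOn (fun p => hd p * (hd p + (-1) * gd p)) unitSq :=
    hdL.integrable_mul (hdL.add (hgL.const_mul (-1)))
  have hin : inner2 hd (fun p => hd p + (-1) * gd p) ≤ 0 :=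
    hμ.inner2_nonpos hh.sq_int (hh.add_const_mul hg hdm hgm (-1)) (hdm.add (hgm.const_mul (-1)))
      fun p hp => by linarith [hle p hp]
  refine ⟨hsub, ?_⟩
  have heq : ∫ p in unitSq, (hd p - gd p) ^ 2 =
      ∫ p in unitSq, ((gd p) ^ 2 - (hd p) ^ 2 + 2 * (hd p * (hd p + (-1) * gd p))) :=
    integral_congr_ae (Eventually.of_forall fun p => by dsimp only; ring)
  have hdiff : IntegrableOn (fun p => (gd p) ^ 2 - (hd p) ^ 2) unitSq := hg.sq_int.sub hh.sq_int
  rw [heq, integral_add hdiff (hcross.const_mul 2),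
    integral_sub hg.sq_int hh.sq_int, integral_const_mul]
  have : ∫ p in unitSq, hd p * (hd p + (-1) * gd p) ≤ 0 := hin
  linarith

/-- Let `h ∈ H²₀` be such that a right-continuous version `h''` of its
partial derivative generates a finite positive measure on `[0,1]²`. Then `h̲ = h`; that is,
`h` is the unique solution of the minimisation problem
`min{‖g‖ : g ∈ H²₀, g ≥ h on [0,1]²}`. -/
theorem stmt14 (h hd hl hld : ℝ × ℝ → ℝ)
    (hh : IsH20 h hd) (hproj : IsProjPolarV h hd hl hld)
    (μ : Measure (ℝ × ℝ)) (hμ : GeneratesMeasure hd μ) :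
    (∀ p ∈ unitSq, hl p = h p) ∧
    ∀ g gd, IsH20 g gd → (∀ p ∈ unitSq, h p ≤ g p) →
      norm2 hd ≤ norm2 gd ∧ (norm2 gd = norm2 hd → ∀ p ∈ unitSq, g p = h p) := by

  refine ⟨?_, fun g gd hg hle => ?_⟩
  · have hlm := hproj.1.aestronglyMeasurable
    have hsq : IntegrableOn (fun p => (hd p - hld p) ^ 2) unitSq :=
      ((hh.memLp hμ.1.measurable.aestronglyMeasurable).sub
        (hproj.1.1.memLp hlm)).integrable_sq
    have hnorm : norm2 (fun q => hd q - hld q) ≤ 0 := by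
      refine le_of_forall_pos_le_add fun δ hδ => ?_
      obtain ⟨g, gd, hg, hlt⟩ := hμ.exists_inPolarV_norm2_sub_lt hh hδ
      linarith [hproj.2 g gd hg]
    have hae := ae_eq_zero_of_integral_sq_nonpos hsq (Real.sqrt_eq_zero'.1
      (le_antisymm hnorm (Real.sqrt_nonneg _)))
    exact hproj.1.1.eq_of_ae_eq hh (hae.mono fun p hp => (sub_eq_zero.1 hp).symm)
  · by_cases hgm : AEStronglyMeasurable gd (volume.restrict unitSq)
    · obtain ⟨hsub, hineq⟩ := hμ.integral_sub_sq_le hh hg hgm hle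
      have hnn : 0 ≤ ∫ p in unitSq, (hd p - gd p) ^ 2 := integral_nonneg fun _ => sq_nonneg _
      refine ⟨Real.sqrt_le_sqrt (by linarith), fun heq => ?_⟩
      have heq' := (Real.sqrt_inj (integral_nonneg fun _ => sq_nonneg _)
        (integral_nonneg fun _ => sq_nonneg _)).1 heq
      have hae := ae_eq_zero_of_integral_sq_nonpos hsub (by linarith)
      exact hg.eq_of_ae_eq hh (hae.mono fun p hp => (sub_eq_zero.1 hp).symm)
    · obtain ⟨s, hs, hns⟩ : ∃ s ∈ Ioo (0:ℝ) 1, ¬ AEStronglyMeasurable gd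
          (volume.restrict (Icc (0:ℝ) s ×ˢ Icc (0:ℝ) s)) := by
        by_contra! hcon
        exact hgm (aestronglyMeasurable_unitSq_of_forall_lt hcon)
      have hs' := Ioo_subset_Icc_self hs
      have hle0 : h (s, s) ≤ 0 :=
        (hle (s, s) ⟨hs', hs'⟩).trans (hg.eq_zero_of_not_aestronglyMeasurable hs' hs' hns).le
      have hd0 : norm2 hd = 0 := by
        rw [norm2, hμ.integral_sq_eq_zero hh hs hs hle0, Real.sqrt_zero]
      refine ⟨hd0.trans_le (Real.sqrt_nonneg _), fun heq => absurd ?_ hgm⟩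
      have hae := ae_eq_zero_of_integral_sq_nonpos hg.sq_int
        (Real.sqrt_eq_zero'.1 (heq.trans hd0))
      exact aestronglyMeasurable_const.congr hae.symm

end
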